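/- There exists N such that for every prime p > N, ζ_p((1,1,1,1,1,1); (−1,−1,−1,−1,−1,−1)) = (4/45)·q_p^6 + (3/4)·q_p·(B_{p−5}/5) + (1/8)·(B_{p−3}/3)² + (2/3)·q_p³·(B_{p−3}/3) in ℤ/pℤ; that is, ζ_𝒜({1̄}^6) = (4/45)𝚚₂⁶ + (3/4)𝚚₂β₅ + (1/8)β₃² + (2/3)𝚚₂³β₃. -/

import Mathlib

open scoped Classical

/-- Finite Euler sum `ζ_p(s;σ)`, with entries `(s_j, σ_j)`: the sum over
`p > n₁ > ⋯ > n_d > 0` of `∏ σ_j^{n_j} n_j^{−s_j}` in `ℤ/pℤ`. -/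
noncomputable def ZsumP (p : ℕ) (l : List (ℕ × ℤ)) : ZMod p :=
  ∑ n : Fin l.length → Fin p,
    if (∀ j, 0 < (n j : ℕ)) ∧ (∀ i j : Fin l.length, i < j → (n j : ℕ) < (n i : ℕ))
    then ∏ j, ((l.get j).2 : ZMod p) ^ (n j : ℕ) * (((n j : ℕ) : ZMod p) ^ (l.get j).1)⁻¹
    else 0

/-- The Fermat quotient `q_p = (2^{p−1} − 1)/p`, reduced mod `p`. -/
def qF (p : ℕ) : ZMod p := (((2 ^ (p - 1) - 1) / p : ℕ) : ZMod p)

/-- Reduction of a rational number mod `p` (numerator over denominator). -/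
noncomputable def rQ (p : ℕ) (x : ℚ) : ZMod p := (x.num : ZMod p) * ((x.den : ℕ) : ZMod p)⁻¹

/-- The rational number `x` is `p`-integral and reduces to `y` modulo `p`. -/
def ReducesTo (p : ℕ) (x : ℚ) (y : ZMod p) : Prop :=
  ∃ a b : ℤ, (b : ZMod p) ≠ 0 ∧ x * b = a ∧ y * b = a

namespace ReducesTo

variable {p : ℕ} [Fact p.Prime] {x x' : ℚ} {y y' : ZMod p}

theorem intCast (n : ℤ) : ReducesTo p n n := ⟨n, 1, by simp, by simp, by simp⟩

theorem natCast (n : ℕ) : ReducesTo p n n := ⟨n, 1, by simp, by simp, by simp⟩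

theorem add (h : ReducesTo p x y) (h' : ReducesTo p x' y') :
    ReducesTo p (x + x') (y + y') := by
  obtain ⟨a, b, hb, h1, h2⟩ := h
  obtain ⟨a', b', hb', h1', h2'⟩ := h'
  refine ⟨a * b' + a' * b, b * b', by push_cast; exact mul_ne_zero hb hb', ?_, ?_⟩
  · push_cast; linear_combination (b' : ℚ) * h1 + b * h1'
  · push_cast; linear_combination (b' : ZMod p) * h2 + b * h2'

theorem mul (h : ReducesTo p x y) (h' : ReducesTo p x' y') :
    ReducesTo p (x * x') (y * y') := by
  obtain ⟨a, b, hb, h1, h2⟩ := h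
  obtain ⟨a', b', hb', h1', h2'⟩ := h'
  refine ⟨a * a', b * b', by push_cast; exact mul_ne_zero hb hb', ?_, ?_⟩
  · push_cast; linear_combination (x' * b' : ℚ) * h1 + a * h1'
  · push_cast; linear_combination (y' * b' : ZMod p) * h2 + a * h2'

theorem neg (h : ReducesTo p x y) : ReducesTo p (-x) (-y) := by
  simpa using (intCast (-1)).mul h

theorem sub (h : ReducesTo p x y) (h' : ReducesTo p x' y') :
    ReducesTo p (x - x') (y - y') := by
  simpa [sub_eq_add_neg] using h.add h'.neg

theorem pow (h : ReducesTo p x y) (n : ℕ) : ReducesTo p (x ^ n) (y ^ n) := by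
  induction n with
  | zero => simpa using natCast (p := p) 1
  | succ n ih => rw [pow_succ, pow_succ]; exact ih.mul h

theorem sum {ι : Type*} (s : Finset ι) {f : ι → ℚ} {g : ι → ZMod p}
    (h : ∀ i ∈ s, ReducesTo p (f i) (g i)) :
    ReducesTo p (∑ i ∈ s, f i) (∑ i ∈ s, g i) := by
  induction s using Finset.induction_on with
  | empty => simpa using natCast (p := p) 0
  | insert a s ha ih =>
    rw [Finset.sum_insert ha, Finset.sum_insert ha]
    exact (h a (by simp)).add (ih fun i hi => h i (by simp [hi]))

theorem inv (h : ReducesTo p x y) (hy : y ≠ 0) : ReducesTo p x⁻¹ y⁻¹ := by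
  obtain ⟨a, b, hb, h1, h2⟩ := h
  have ha : (a : ZMod p) ≠ 0 := by rw [← h2]; exact mul_ne_zero hy hb
  have hx : x ≠ 0 := by
    rintro rfl
    apply ha
    have : a = 0 := by exact_mod_cast (by simpa using h1.symm : (a : ℚ) = 0)
    simp [this]
  refine ⟨b, a, ha, ?_, ?_⟩
  · rw [← h1]; field_simp
  · rw [← h2]; field_simp

theorem div (h : ReducesTo p x y) (h' : ReducesTo p x' y') (hy : y' ≠ 0) :
    ReducesTo p (x / x') (y / y') := by
  simpa [div_eq_mul_inv] using h.mul (h'.inv hy)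

theorem den_ne_zero (h : ReducesTo p x y) : (x.den : ZMod p) ≠ 0 := by
  obtain ⟨a, b, hb, h1, -⟩ := h
  have key : x.num * b = a * x.den := by
    have h3 := Rat.mul_den_eq_num x
    have : (x.num : ℚ) * b = a * x.den := by linear_combination (x.den : ℚ) * h1 - b * h3
    exact_mod_cast this
  intro hd
  have hn : (x.num : ZMod p) * b = 0 := by
    have := congrArg (Int.cast : ℤ → ZMod p) key
    push_cast at this
    rw [this, hd, mul_zero]
  have hn' := (mul_eq_zero.mp hn).resolve_right hb
  rw [ZMod.natCast_eq_zero_iff] at hd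
  rw [ZMod.intCast_zmod_eq_zero_iff_dvd, ← Int.natCast_dvd_natCast.symm.trans Int.dvd_natAbs] at hn'
  exact (Fact.out : p.Prime).one_lt.ne' (Nat.dvd_one.mp (x.reduced ▸ Nat.dvd_gcd hn' hd))

theorem rQ_eq (h : ReducesTo p x y) : rQ p x = y := by
  have hd := h.den_ne_zero
  obtain ⟨a, b, hb, h1, h2⟩ := h
  have key : x.num * b = a * x.den := by
    have h3 := Rat.mul_den_eq_num x
    have : (x.num : ℚ) * b = a * x.den := by linear_combination (x.den : ℚ) * h1 - b * h3
    exact_mod_cast this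
  have key' := congrArg (Int.cast : ℤ → ZMod p) key
  push_cast at key'
  rw [rQ, mul_inv_eq_iff_eq_mul₀ hd]
  apply mul_right_cancel₀ hb
  rw [key', ← h2]; ring

theorem unique (h : ReducesTo p x y) (h' : ReducesTo p x y') : y = y' :=
  h.rQ_eq.symm.trans h'.rQ_eq

end ReducesTo

theorem natCast_ne_zero_of_lt {p n : ℕ} (hn : n ≠ 0) (h : n < p) : (n : ZMod p) ≠ 0 := by
  rw [Ne, ZMod.natCast_eq_zero_iff]
  exact fun hd => (Nat.le_of_dvd (Nat.pos_of_ne_zero hn) hd).not_gt h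

theorem exists_reducesTo_bernoulli {p : ℕ} [Fact p.Prime] (n : ℕ) (hn : n + 1 < p) :
    ∃ y : ZMod p, ReducesTo p (bernoulli n) y := by
  induction n using Nat.strong_induction_on with
  | _ n ih =>
    choose! b hb using ih
    have h1 := sum_bernoulli (n + 1)
    rw [Finset.sum_range_succ, Nat.choose_succ_self_right] at h1
    have h2 : bernoulli n = (((if n + 1 = 1 then 1 else 0 : ℕ) : ℚ)
        - ∑ k ∈ Finset.range n, ((n + 1).choose k : ℚ) * bernoulli k) / ((n + 1 : ℕ) : ℚ) := by
      rw [eq_div_iff (by positivity)]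
      push_cast at h1 ⊢
      linear_combination h1
    rw [h2]
    refine ⟨_, ((ReducesTo.natCast _).sub (ReducesTo.sum _
      (g := fun k => ((n + 1).choose k : ZMod p) * b k) fun i hi => ?_)).div
      (ReducesTo.natCast _) (natCast_ne_zero_of_lt (by omega) hn)⟩
    have hi := Finset.mem_range.mp hi
    exact (ReducesTo.natCast _).mul (hb i hi (by omega))

theorem bernoulli_eval_half (n : ℕ) :
    (Polynomial.bernoulli n).eval (1 / 2 : ℚ) = (2 * (1 / 2) ^ n - 1) * bernoulli n := by
  have h1 := Polynomial.bernoulli_generating_function (A := ℚ) (1 / 2)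
  have h2 := bernoulliPowerSeries_mul_exp_sub_one ℚ
  have h3 := congrArg (PowerSeries.rescale (1 / 2 : ℚ)) h2
  have h4 : PowerSeries.rescale (1 / 2 : ℚ) (PowerSeries.exp ℚ) ^ 2 = PowerSeries.exp ℚ := by
    rw [← map_pow, PowerSeries.exp_pow_eq_rescale_exp, PowerSeries.rescale_rescale]
    norm_num
  have hne : PowerSeries.exp ℚ - 1 ≠ 0 := by
    intro h
    rw [h, mul_zero] at h2
    exact PowerSeries.X_ne_zero h2.symm
  rw [map_mul, map_sub, map_one, PowerSeries.rescale_X] at h3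
  have h5 : PowerSeries.C (2 : ℚ) * PowerSeries.C (1 / 2 : ℚ) = 1 := by
    rw [← map_mul]; norm_num
  have key : (PowerSeries.mk fun n => Polynomial.aeval (1 / 2 : ℚ)
      ((1 / (n.factorial : ℚ)) • Polynomial.bernoulli n))
      = PowerSeries.C (2 : ℚ) * PowerSeries.rescale (1 / 2 : ℚ) (bernoulliPowerSeries ℚ)
        - bernoulliPowerSeries ℚ := by
    apply mul_right_cancel₀ hne
    rw [h1, sub_mul, h2]
    generalize PowerSeries.rescale (1 / 2 : ℚ) (PowerSeries.exp ℚ) = E at *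
    rw [← h4]
    linear_combination (-PowerSeries.C (2 : ℚ) * (E + 1)) * h3
      - PowerSeries.X * (E + 1) * h5
  have := congrArg (PowerSeries.coeff n) key
  simp only [PowerSeries.coeff_mk, map_sub, PowerSeries.coeff_C_mul, PowerSeries.coeff_rescale,
    bernoulliPowerSeries, map_smul, smul_eq_mul, Polynomial.coe_aeval_eq_eval,
    Algebra.algebraMap_self, RingHom.id_apply] at this
  have hf : (n.factorial : ℚ) ≠ 0 := by positivity
  field_simp at this ⊢
  linear_combination this

theorem reducesTo_sum_pow_half {p m h : ℕ} [Fact p.Prime] (hp : p = 2 * h + 1) (hm : m + 1 < p) :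
    ReducesTo p ((2 * (1 / 2) ^ (m + 1) - 2) * bernoulli (m + 1) / ((m + 1 : ℕ) : ℚ))
      (∑ j ∈ Finset.range (h + 1), (j : ZMod p) ^ m) := by
  have h2 : (2 : ZMod p) ≠ 0 := by
    have := (Fact.out : p.Prime).two_le
    exact_mod_cast natCast_ne_zero_of_lt (p := p) (n := 2) (by omega) (by omega)
  have half : ((h + 1 : ℕ) : ZMod p) = 1 / 2 := by
    rw [eq_div_iff h2]
    have : ((2 * h + 1 : ℕ) : ZMod p) = 0 := by rw [← hp]; simp
    push_cast at this ⊢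
    linear_combination this
  have hb : ∀ i ∈ Finset.range (m + 1), ∃ y : ZMod p, ReducesTo p (bernoulli i) y :=
    fun i hi => exists_reducesTo_bernoulli i (by have := Finset.mem_range.mp hi; omega)
  choose! b hb using hb
  have gen : ∀ (x : ℚ) (y : ZMod p), ReducesTo p x y → ReducesTo p
      (∑ i ∈ Finset.range (m + 1), bernoulli i * ((m + 1).choose i : ℕ) * x ^ (m + 1 - i)
        / ((m + 1 : ℕ) : ℚ))
      (∑ i ∈ Finset.range (m + 1), b i * ((m + 1).choose i : ℕ) * y ^ (m + 1 - i)
        / ((m + 1 : ℕ) : ZMod p)) := fun x y hxy =>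
    ReducesTo.sum _ fun i hi => (((hb i hi).mul (.natCast _)).mul (hxy.pow _)).div (.natCast _)
      (natCast_ne_zero_of_lt (by omega) hm)
  have e1 := gen _ _ (.natCast (h + 1))
  have e2 := gen _ _ ((ReducesTo.natCast (p := p) 1).div (.natCast 2) (by exact_mod_cast h2))
  have e3 : ReducesTo p (∑ k ∈ Finset.range (h + 1), (k : ℚ) ^ m)
      (∑ j ∈ Finset.range (h + 1), (j : ZMod p) ^ m) :=
    ReducesTo.sum _ fun i _ => (ReducesTo.natCast i).pow m
  rw [sum_range_pow] at e3
  push_cast at e1 e2 e3 half ⊢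
  rw [half] at e1
  rw [e3.unique e1]
  convert e2 using 1
  have hev : (Polynomial.bernoulli (m + 1)).eval (1 / 2 : ℚ) = ∑ i ∈ Finset.range (m + 1 + 1),
      bernoulli i * ((m + 1).choose i : ℕ) * (1 / 2) ^ (m + 1 - i) := by
    simp [Polynomial.bernoulli, Polynomial.eval_finsetSum, Polynomial.eval_monomial]
  rw [bernoulli_eval_half, Finset.sum_range_succ] at hev
  rw [← Finset.sum_div]
  congr 1
  simp only [Nat.choose_self, tsub_self] at hev
  push_cast at hev
  linear_combination hev

theorem sum_zmod_eq_sum_range {p : ℕ} [NeZero p] {M : Type*} [AddCommMonoid M] (f : ZMod p → M) :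
    ∑ x, f x = ∑ n ∈ Finset.range p, f (n : ZMod p) := by
  refine Finset.sum_bij' (fun x _ => x.val) (fun n _ => (n : ZMod p)) ?_ ?_ ?_ ?_ ?_
  · intro x _; exact Finset.mem_range.mpr x.val_lt
  · intros; exact Finset.mem_univ _
  · intro x _; exact ZMod.natCast_zmod_val x
  · intro n hn; exact ZMod.val_cast_of_lt (Finset.mem_range.mp hn)
  · intro x _; rw [ZMod.natCast_zmod_val]

theorem sum_range_inv_pow_eq_zero {p k : ℕ} [Fact p.Prime] (hk : k < p - 1) :
    ∑ n ∈ Finset.range p, ((n : ZMod p)⁻¹) ^ k = 0 := by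
  rw [← sum_zmod_eq_sum_range (fun x : ZMod p => x⁻¹ ^ k),
    ← FiniteField.sum_pow_lt_card_sub_one (K := ZMod p) k (by rwa [ZMod.card])]
  exact Equiv.sum_comp (Equiv.inv (ZMod p)) (fun x => x ^ k)

theorem sum_range_one_add_neg_one_pow_mul {R : Type*} [CommRing R] (h : ℕ) (f : ℕ → R) :
    ∑ n ∈ Finset.range (2 * h + 1), (1 + (-1) ^ n) * f n
      = 2 * ∑ j ∈ Finset.range (h + 1), f (2 * j) := by
  induction h with
  | zero => simp; ring
  | succ h ih =>
    rw [Finset.sum_range_succ _ (h + 1), mul_add 2 (Finset.sum _ _), ← ih,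
      show 2 * (h + 1) = 2 * h + 1 + 1 by ring, Finset.sum_range_succ, Finset.sum_range_succ]
    have : ((-1 : R)) ^ (2 * h) = 1 := by rw [pow_mul]; simp
    simp only [pow_succ, this]
    ring

theorem inv_pow_eq_pow_sub {p k : ℕ} [Fact p.Prime] (hk : 0 < k) (hkp : k < p - 1) (x : ZMod p) :
    x⁻¹ ^ k = x ^ (p - 1 - k) := by
  rcases eq_or_ne x 0 with rfl | hx
  · rw [inv_zero, zero_pow hk.ne', zero_pow (by omega)]
  · rw [inv_pow]
    apply inv_eq_of_mul_eq_one_right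
    rw [← pow_add, show k + (p - 1 - k) = p - 1 by omega, ZMod.pow_card_sub_one_eq_one hx]

theorem sum_alternating_inv_pow_even {p k : ℕ} [Fact p.Prime] (he : Even k) (hk : k < p - 1) :
    ∑ n ∈ Finset.range p, ((-1) ^ n * (n : ZMod p)⁻¹) ^ k = 0 := by
  rw [← sum_range_inv_pow_eq_zero hk]
  refine Finset.sum_congr rfl fun n _ => ?_
  rw [mul_pow, ← pow_mul, mul_comm n, pow_mul, he.neg_one_pow, one_pow, one_mul]

theorem sum_alternating_inv_pow_odd {p h k : ℕ} [Fact p.Prime] (hp : p = 2 * h + 1) (ho : Odd k)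
    (hk : k < p - 1) :
    ∑ n ∈ Finset.range p, ((-1) ^ n * (n : ZMod p)⁻¹) ^ k
      = 2 * (2 : ZMod p)⁻¹ ^ k * ∑ j ∈ Finset.range (h + 1), (j : ZMod p) ^ (p - 1 - k) := by
  have h0 := sum_range_inv_pow_eq_zero hk
  have h1 := sum_range_one_add_neg_one_pow_mul h (fun n => (n : ZMod p)⁻¹ ^ k)
  rw [← hp] at h1
  simp only [add_mul, one_mul, Finset.sum_add_distrib] at h1
  rw [h0, zero_add] at h1
  calc _ = ∑ n ∈ Finset.range p, (-1) ^ n * (n : ZMod p)⁻¹ ^ k := by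
        refine Finset.sum_congr rfl fun n _ => ?_
        rw [mul_pow, ← pow_mul, mul_comm n, pow_mul, ho.neg_one_pow]
    _ = 2 * (2 : ZMod p)⁻¹ ^ k * ∑ j ∈ Finset.range (h + 1), (j : ZMod p) ^ (p - 1 - k) := by
        rw [h1, Finset.mul_sum, Finset.mul_sum]
        refine Finset.sum_congr rfl fun j _ => ?_
        rw [← inv_pow_eq_pow_sub ho.pos hk, mul_assoc, ← mul_pow, Nat.cast_mul, mul_inv,
          Nat.cast_ofNat]

theorem choose_prime_sub_one {p : ℕ} [Fact p.Prime] (j : ℕ) (hj : j < p) :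
    ((p - 1).choose j : ZMod p) = (-1) ^ j := by
  induction j with
  | zero => simp
  | succ j ih =>
    have hp := (Fact.out : p.Prime)
    have h1 : p.choose (j + 1) = (p - 1).choose j + (p - 1).choose (j + 1) := by
      conv_lhs => rw [show p = p - 1 + 1 by have := hp.pos; omega]
      exact Nat.choose_succ_succ _ _
    have h2 : (p.choose (j + 1) : ZMod p) = 0 := by
      rw [ZMod.natCast_eq_zero_iff]
      exact hp.dvd_choose_self (by omega) hj
    rw [h1] at h2
    push_cast at h2
    rw [ih (by omega)] at h2
    rw [pow_succ]
    linear_combination h2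

theorem sum_alternating_inv {p : ℕ} [Fact p.Prime] (hp2 : p ≠ 2) :
    ∑ n ∈ Finset.range p, ((-1) ^ n * (n : ZMod p)⁻¹) = -2 * qF p := by
  have hp := (Fact.out : p.Prime)
  have hpos := hp.pos
  have hdvd : p ∣ 2 ^ (p - 1) - 1 := by
    rw [← ZMod.natCast_eq_zero_iff, Nat.cast_sub Nat.one_le_two_pow]
    push_cast
    rw [sub_eq_zero]
    apply ZMod.pow_card_sub_one_eq_one
    have := hp.two_le
    exact_mod_cast natCast_ne_zero_of_lt (p := p) (n := 2) (by omega) (by omega)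
  have hchoose : ∀ n ∈ Finset.Ico 1 p, p * (p.choose n / p) = p.choose n := fun n hn => by
    have := Finset.mem_Ico.mp hn
    exact Nat.mul_div_cancel' (hp.dvd_choose_self (by omega) this.2)
  have hterm : ∀ n ∈ Finset.Ico 1 p,
      ((p.choose n / p : ℕ) : ZMod p) = -((-1) ^ n * (n : ZMod p)⁻¹) := fun n hn => by
    obtain ⟨hn1, hn2⟩ := Finset.mem_Ico.mp hn
    have h1 := Nat.add_one_mul_choose_eq (p - 1) (n - 1)
    rw [Nat.sub_add_cancel hpos, Nat.sub_add_cancel hn1, ← hchoose n hn, mul_assoc] at h1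
    have h2 := congrArg (Nat.cast : ℕ → ZMod p) (Nat.eq_of_mul_eq_mul_left hpos h1)
    rw [choose_prime_sub_one _ (by omega)] at h2
    have hn0 := natCast_ne_zero_of_lt (by omega) hn2
    have h3 : (-1 : ZMod p) ^ n = (-1) ^ (n - 1) * (-1) := by
      rw [← pow_succ, Nat.sub_add_cancel hn1]
    push_cast at h2
    rw [h3, h2]
    field_simp
  have hsum : ∑ n ∈ Finset.Ico 1 p, p.choose n / p = 2 * ((2 ^ (p - 1) - 1) / p) := by
    apply Nat.eq_of_mul_eq_mul_left hpos
    rw [Finset.mul_sum, Finset.sum_congr rfl hchoose, mul_left_comm, Nat.mul_div_cancel' hdvd,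
      Nat.mul_sub, ← pow_succ', Nat.sub_add_cancel hpos]
    have h1 := Nat.sum_range_choose p
    rw [Finset.sum_range_succ, Finset.range_eq_Ico, Finset.sum_eq_sum_Ico_succ_bot hpos] at h1
    simp only [Nat.choose_zero_right, Nat.choose_self, zero_add] at h1
    change ∑ n ∈ Finset.Ico 1 p, p.choose n = _
    omega
  rw [Finset.range_eq_Ico, Finset.sum_eq_sum_Ico_succ_bot hpos]
  have h := congrArg (Nat.cast : ℕ → ZMod p) hsum
  rw [Nat.cast_sum, Finset.sum_congr rfl hterm, Finset.sum_neg_distrib] at h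
  push_cast at h
  simp only [zero_add, Nat.cast_zero, inv_zero, mul_zero, qF]
  linear_combination -h

theorem aeval_psum {σ R : Type*} [Fintype σ] [CommRing R] (x : σ → R) (n : ℕ) :
    MvPolynomial.aeval x (MvPolynomial.psum σ R n) = ∑ i, x i ^ n := by
  simp [MvPolynomial.psum]

theorem esymm_six_of_psum_even_eq_zero {σ R : Type*} [Fintype σ] [CommRing R] (x : σ → R)
    (h2 : ∑ i, x i ^ 2 = 0) (h4 : ∑ i, x i ^ 4 = 0) (h6 : ∑ i, x i ^ 6 = 0) :
    720 * MvPolynomial.aeval x (MvPolynomial.esymm σ R 6)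
      = (∑ i, x i) ^ 6 + 40 * (∑ i, x i) ^ 3 * ∑ i, x i ^ 3 + 40 * (∑ i, x i ^ 3) ^ 2
        + 144 * (∑ i, x i) * ∑ i, x i ^ 5 := by
  have newton := fun k => congrArg (MvPolynomial.aeval x) (MvPolynomial.mul_esymm_eq_sum σ R k)
  simp only [map_mul, map_sum, map_pow, map_neg, map_one, map_natCast, aeval_psum] at newton
  have n2 := newton 2
  have n3 := newton 3
  have n4 := newton 4
  have n5 := newton 5
  have n6 := newton 6
  simp only [Finset.sum_filter, Finset.Nat.sum_antidiagonal_eq_sum_range_succ_mk,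
    Finset.sum_range_succ, Finset.sum_range_zero] at n2 n3 n4 n5 n6
  norm_num [h2, h4, h6] at n2 n3 n4 n5 n6
  generalize ∑ i, x i = p1 at *
  generalize ∑ i, x i ^ 3 = p3 at *
  generalize ∑ i, x i ^ 5 = p5 at *
  rw [MvPolynomial.aeval_eq_eval]
  linear_combination 120 * n6 + 24 * p1 * n5 + 6 * p1 ^ 2 * n4 + (2 * p1 ^ 3 + 40 * p3) * n3
    + (p1 ^ 4 + 32 * p1 * p3) * n2

theorem aeval_esymm_eq_sum_strictAnti {p d : ℕ} {R : Type*} [CommRing R] (x : Fin p → R) :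
    MvPolynomial.aeval x (MvPolynomial.esymm (Fin p) R d)
      = ∑ n : Fin d → Fin p, if StrictAnti n then ∏ j, x (n j) else 0 := by
  rw [MvPolynomial.esymm, map_sum, ← Finset.sum_filter]
  simp only [map_prod, MvPolynomial.aeval_X]
  symm
  refine Finset.sum_bij' (fun n _ => Finset.univ.image n)
    (fun s hs j => s.orderEmbOfFin (Finset.mem_powersetCard.mp hs).2 j.rev) ?_ ?_ ?_ ?_ ?_
  · intro n hn
    have hn := (Finset.mem_filter.mp hn).2
    rw [Finset.mem_powersetCard]
    exact ⟨Finset.subset_univ _, by rw [Finset.card_image_of_injective _ hn.injective]; simp⟩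
  · intro s hs
    simp only [Finset.mem_filter, Finset.mem_univ, true_and]
    exact (OrderEmbedding.strictMono _).comp_strictAnti Fin.rev_strictAnti
  · intro n hn
    have hn := (Finset.mem_filter.mp hn).2
    have hc : (Finset.univ.image n).card = d := by
      rw [Finset.card_image_of_injective _ hn.injective]; simp
    have := Finset.orderEmbOfFin_unique hc (f := n ∘ Fin.rev)
      (fun j => Finset.mem_image_of_mem _ (Finset.mem_univ _)) (hn.comp Fin.rev_strictAnti)
    funext j
    rw [← this]
    simp
  · intro s hs
    ext i
    have hr := Set.ext_iff.mp (Finset.range_orderEmbOfFin s (Finset.mem_powersetCard.mp hs).2) i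
    rw [Set.mem_range, Finset.mem_coe] at hr
    rw [← hr, Finset.mem_image]
    exact ⟨fun ⟨j, _, hj⟩ => ⟨_, hj⟩, fun ⟨j, hj⟩ => ⟨j.rev, Finset.mem_univ _, by simpa using hj⟩⟩
  · intro n hn
    have hn := (Finset.mem_filter.mp hn).2
    rw [Finset.prod_image hn.injective.injOn]

theorem ZsumP_eq_sum_strictAnti (p : ℕ) [Fact p.Prime] (l : List (ℕ × ℤ))
    (hl : ∀ a ∈ l, a = (1, -1)) :
    ZsumP p l = ∑ n : Fin l.length → Fin p, if StrictAnti n then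
      ∏ j, ((-1) ^ (n j : ℕ) * ((n j : ℕ) : ZMod p)⁻¹) else 0 := by
  refine Finset.sum_congr rfl fun n _ => ?_
  have hget : ∀ j : Fin l.length, l.get j = (1, -1) := fun j => hl _ (List.get_mem _ _)
  have hanti : (∀ i j : Fin l.length, i < j → (n j : ℕ) < (n i : ℕ)) ↔ StrictAnti n :=
    ⟨fun h i j hij => h i j hij, fun h i j hij => h hij⟩
  simp only [hget, hanti, pow_one, Int.cast_neg, Int.cast_one]
  by_cases hpos : ∀ j, 0 < (n j : ℕ)
  · simp [hpos]
  · rw [if_neg fun h => hpos h.1]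
    push Not at hpos
    obtain ⟨j, hj⟩ := hpos
    rw [Finset.prod_eq_zero (Finset.mem_univ j) (by simp [Nat.le_zero.mp hj]), ite_self]

theorem ZsumP_replicate (p d : ℕ) [Fact p.Prime] :
    ZsumP p (List.replicate d ((1 : ℕ), (-1 : ℤ)))
      = MvPolynomial.aeval (fun n : Fin p => (-1) ^ (n : ℕ) * ((n : ℕ) : ZMod p)⁻¹)
        (MvPolynomial.esymm (Fin p) (ZMod p) d) := by
  rw [ZsumP_eq_sum_strictAnti p _ fun a ha => List.eq_of_mem_replicate ha,
    ← aeval_esymm_eq_sum_strictAnti (d := (List.replicate d ((1 : ℕ), (-1 : ℤ))).length)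
      (fun n : Fin p => (-1) ^ (n : ℕ) * ((n : ℕ) : ZMod p)⁻¹), List.length_replicate]

theorem sum_alternating_inv_pow_eq_bernoulli {p k : ℕ} [Fact p.Prime] (ho : Odd k)
    (hk1 : 1 < k) (hk : k + 1 < p) :
    k * ∑ n ∈ Finset.range p, ((-1) ^ n * (n : ZMod p)⁻¹) ^ k
      = -(2 * (2 : ZMod p)⁻¹ ^ k * (2 ^ k - 2)) * (k * rQ p (bernoulli (p - k) / k)) := by
  have hk0 := ho.pos
  have hp2 : p ≠ 2 := by omega
  obtain ⟨h, hp⟩ := (Fact.out : p.Prime).odd_of_ne_two hp2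
  have h2 : (2 : ZMod p) ≠ 0 := by
    exact_mod_cast natCast_ne_zero_of_lt (p := p) (n := 2) (by omega) (by omega)
  have hkne : (k : ZMod p) ≠ 0 := natCast_ne_zero_of_lt (by omega) (by omega)
  have hm : p - 1 - k + 1 = p - k := by omega
  have hred := reducesTo_sum_pow_half (m := p - 1 - k) hp (by omega)
  obtain ⟨y, hy⟩ := exists_reducesTo_bernoulli (p := p) (p - k) (by omega)
  have hcast : ((p - k : ℕ) : ZMod p) = -k := by
    rw [Nat.cast_sub (by omega)]; simp
  rw [hm] at hred
  have hred' := ((((ReducesTo.natCast (p := p) 2).mul (((ReducesTo.natCast 1).div (.natCast 2)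
    (by exact_mod_cast h2)).pow (p - k))).sub (.natCast 2)).mul hy).div (.natCast (p - k))
    (natCast_ne_zero_of_lt (by omega) (by omega))
  push_cast at hred hred'
  rw [sum_alternating_inv_pow_odd hp ho (by omega), hred.unique hred',
    (hy.div (.natCast k) hkne).rQ_eq]
  have hpow : (2 : ZMod p) ^ (p - k) * 2 ^ k = 2 := by
    rw [← pow_add, show p - k + k = p by omega, ZMod.pow_card]
  have hpow' : (1 / 2 : ZMod p) ^ (p - k) = 2 ^ k / 2 := by
    rw [one_div, inv_pow, eq_div_iff h2, inv_mul_eq_iff_eq_mul₀ (pow_ne_zero _ h2), hpow]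
  rw [hpow', hcast]
  field_simp

/-- For all sufficiently large primes `p`:
`ζ_p({1̄}⁶) = (4/45)q_p⁶ + (3/4)q_p(B_{p−5}/5) + (1/8)(B_{p−3}/3)² + (2/3)q_p³(B_{p−3}/3)`
in `ℤ/pℤ`; i.e. `ζ_𝒜({1̄}⁶) = (4/45)𝚚₂⁶ + (3/4)𝚚₂β₅ + (1/8)β₃² + (2/3)𝚚₂³β₃`. -/
theorem zeta_bar_one_six :
    ∃ N : ℕ, ∀ p : ℕ, N < p → p.Prime →
      ZsumP p (List.replicate 6 ((1 : ℕ), (-1 : ℤ)))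
        = rQ p (4/45) * qF p ^ 6
          + rQ p (3/4) * qF p * rQ p (bernoulli (p - 5) / 5)
          + rQ p (1/8) * rQ p (bernoulli (p - 3) / 3) ^ 2
          + rQ p (2/3) * qF p ^ 3 * rQ p (bernoulli (p - 3) / 3) := by
  refine ⟨10, fun p hp10 hp => ?_⟩
  have : Fact p.Prime := ⟨hp⟩
  have ne : ∀ n : ℕ, n ≠ 0 → n ≤ 10 → (n : ZMod p) ≠ 0 := fun n h0 hn =>
    natCast_ne_zero_of_lt h0 (by omega)
  have h2 : (2 : ZMod p) ≠ 0 := by exact_mod_cast ne 2 (by norm_num) (by norm_num)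
  have h3 : (3 : ZMod p) ≠ 0 := by exact_mod_cast ne 3 (by norm_num) (by norm_num)
  have h5 : (5 : ZMod p) ≠ 0 := by exact_mod_cast ne 5 (by norm_num) (by norm_num)
  have hodd : ∀ k : ℕ, ∑ n : Fin p, ((-1) ^ (n : ℕ) * ((n : ℕ) : ZMod p)⁻¹) ^ k
      = ∑ n ∈ Finset.range p, ((-1) ^ n * (n : ZMod p)⁻¹) ^ k := fun k =>
    Fin.sum_univ_eq_sum_range (fun n => ((-1) ^ n * (n : ZMod p)⁻¹) ^ k) p
  have heven : ∀ k : ℕ, Even k → k ≤ 6 →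
      ∑ n : Fin p, ((-1) ^ (n : ℕ) * ((n : ℕ) : ZMod p)⁻¹) ^ k = 0 := fun k he hk => by
    rw [hodd, sum_alternating_inv_pow_even he (by omega)]
  have key := esymm_six_of_psum_even_eq_zero
    (fun n : Fin p => (-1) ^ (n : ℕ) * ((n : ℕ) : ZMod p)⁻¹)
    (heven 2 (by decide) (by norm_num)) (heven 4 (by decide) (by norm_num))
    (heven 6 (by decide) (by norm_num))
  have p1 := hodd 1
  simp only [pow_one] at p1
  rw [sum_alternating_inv (by omega)] at p1
  have p3 := sum_alternating_inv_pow_eq_bernoulli (p := p) (k := 3) (by decide) (by norm_num)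
    (by omega)
  have p5 := sum_alternating_inv_pow_eq_bernoulli (p := p) (k := 5) (by decide) (by norm_num)
    (by omega)
  rw [← ZsumP_replicate, p1, hodd, hodd] at key
  push_cast at p3 p5
  generalize ∑ n ∈ Finset.range p, ((-1) ^ n * (n : ZMod p)⁻¹) ^ 3 = s3 at *
  generalize ∑ n ∈ Finset.range p, ((-1) ^ n * (n : ZMod p)⁻¹) ^ 5 = s5 at *
  generalize rQ p (bernoulli (p - 3) / 3) = β3 at *
  generalize rQ p (bernoulli (p - 5) / 5) = β5 at *
  have r : ∀ a b : ℕ, (b : ZMod p) ≠ 0 → rQ p (a / b) = a / b := fun a b hb =>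
    ((ReducesTo.natCast a).div (.natCast b) hb).rQ_eq
  have h45 : ((45 : ℕ) : ZMod p) ≠ 0 := by
    rw [show ((45 : ℕ) : ZMod p) = 3 * 3 * 5 by norm_num]
    exact mul_ne_zero (mul_ne_zero h3 h3) h5
  have h8 := ne 8 (by norm_num) (by norm_num)
  have r1 := r 4 45 h45
  have r2 := r 3 4 (ne 4 (by norm_num) (by norm_num))
  have r3 := r 1 8 h8
  have r4 := r 2 3 (by exact_mod_cast h3)
  push_cast at r1 r2 r3 r4 h45 h8
  have h4 : (4 : ZMod p) ≠ 0 := by exact_mod_cast ne 4 (by norm_num) (by norm_num)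
  have s3eq : s3 = -(3 / 2) * β3 := by
    apply mul_left_cancel₀ h3
    rw [p3]
    field_simp
    ring
  have s5eq : s5 = -(15 / 8) * β5 := by
    apply mul_left_cancel₀ h5
    rw [p5]
    field_simp
    ring
  have h720 : (720 : ZMod p) ≠ 0 := by
    rw [show (720 : ZMod p) = 45 * (8 * 2) by norm_num]
    exact mul_ne_zero h45 (mul_ne_zero h8 h2)
  apply mul_left_cancel₀ h720
  rw [key, r1, r2, r3, r4, s3eq, s5eq]
  field_simp
  ring
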